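/- Let I be the ideal of the polynomial ring ℂ[y₀,y₁,y₂,y₃,y₄,y₅] generated by the two polynomials y₅⁴ − y₀y₁y₂(y₀+y₁+y₂+y₃+y₄) and 2y₅² − (y₀y₁+y₀y₂+y₁y₂−y₃y₄). Then I is a prime ideal and the quotient ring ℂ[y₀,…,y₅]/I is an integrally closed (normal) integral domain. -/

import Mathlib

open MvPolynomial

/-- The quartic `y₅⁴ − y₀y₁y₂(y₀+y₁+y₂+y₃+y₄)`. -/
noncomputable def fpoly : MvPolynomial (Fin 6) ℂ :=
  X 5 ^ 4 - X 0 * X 1 * X 2 * (X 0 + X 1 + X 2 + X 3 + X 4)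

/-- The quadric `2y₅² − (y₀y₁+y₀y₂+y₁y₂−y₃y₄)`. -/
noncomputable def gpoly : MvPolynomial (Fin 6) ℂ :=
  2 * X 5 ^ 2 - (X 0 * X 1 + X 0 * X 2 + X 1 * X 2 - X 3 * X 4)

/-- A quotient of elements of an integrally closed domain that is integral, computed in any larger
field, is already a quotient in the domain. -/
theorem IsIntegrallyClosed.dvd_of_isIntegral {R L : Type*} [CommRing R] [IsDomain R]
    [IsIntegrallyClosed R] [Field L] [Algebra R L]
    (hinj : Function.Injective (algebraMap R L)) {y : L} (hy : IsIntegral R y) {n m : R}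
    (hn : n ≠ 0) (h : algebraMap R L n * y = algebraMap R L m) : n ∣ m := by
  have hn' : algebraMap R L n ≠ 0 := by simpa using hinj.ne hn
  let φ : FractionRing R →ₐ[R] L := IsFractionRing.liftAlgHom (g := Algebra.ofId R L) hinj
  have hφ : φ (algebraMap R _ m / algebraMap R _ n) = y := by
    rw [map_div₀, AlgHom.commutes, AlgHom.commutes, ← h, mul_div_cancel_left₀ _ hn']
  rw [← hφ, isIntegral_algHom_iff φ φ.toRingHom.injective,
    IsIntegrallyClosed.isIntegral_iff] at hy
  obtain ⟨r, hr⟩ := hy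
  have hn'' : algebraMap R (FractionRing R) n ≠ 0 := by simpa using hn
  refine ⟨r, IsFractionRing.injective R (FractionRing R) ?_⟩
  rw [map_mul, hr, mul_div_cancel₀ _ hn'']

/-- A radical element of a domain that is neither zero nor a unit is not a square. -/
theorem IsRadical.not_isSquare {R : Type*} [CommRing R] [IsDomain R] {D : R} (hD : IsRadical D)
    (hu : ¬IsUnit D) (h0 : D ≠ 0) : ¬IsSquare D := by
  rintro ⟨c, hc⟩
  obtain ⟨e, he⟩ : D ∣ c := hD 2 c (by rw [hc, sq])
  refine hu (.of_mul_eq_one (e ^ 2) (mul_left_cancel₀ h0 ?_))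
  linear_combination -(c + D * e) * he - hc

/-- The product of a prime and a radical element it does not divide is radical. -/
theorem Prime.isRadical_mul {R : Type*} [CommRing R] [IsDomain R] {p q : R} (hp : Prime p)
    (hq : IsRadical q) (hpq : ¬p ∣ q) : IsRadical (p * q) := by
  intro n x h
  obtain ⟨e, rfl⟩ := hq n x ((dvd_mul_left q p).trans h)
  rw [mul_comm p q]
  exact mul_dvd_mul_left q
    ((hp.dvd_or_dvd (hp.dvd_of_dvd_pow ((dvd_mul_right p q).trans h))).resolve_left hpq)

namespace QuadraticAlgebra

variable {R : Type*} [CommRing R] {D : R}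

theorem mk_eq_algebraMap_add (a b : R) :
    (⟨a, b⟩ : QuadraticAlgebra R D 0) =
      algebraMap R _ a + algebraMap R _ b * (omega : QuadraticAlgebra R D 0) := by
  ext <;> simp [algebraMap_eq]

theorem omega_sq : (omega : QuadraticAlgebra R D 0) ^ 2 = algebraMap R _ D := by
  ext <;> simp [sq, algebraMap_eq]

theorem star_algebraMap (a : R) :
    star (algebraMap R (QuadraticAlgebra R D 0) a) = algebraMap R _ a := by
  ext <;> simp [algebraMap_eq]

theorem star_omega : star (omega : QuadraticAlgebra R D 0) = -omega := by
  ext <;> simp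

/-- The square root of a radical element is radical. -/
theorem isRadical_omega (hD : IsRadical D) : IsRadical (omega : QuadraticAlgebra R D 0) := by
  rw [isRadical_iff_pow_one_lt 2 one_lt_two]
  rintro ⟨a, b⟩ ⟨⟨u, v⟩, h⟩
  have hre := congrArg QuadraticAlgebra.re h
  simp only [sq, re_mul, omega_re, omega_im] at hre
  obtain ⟨c, rfl⟩ : D ∣ a := hD 2 a ⟨v - b ^ 2, by linear_combination hre⟩
  exact ⟨⟨b, c⟩, by ext <;> simp⟩

theorem isUnit_two (h : IsUnit (2 : R)) : IsUnit (2 : QuadraticAlgebra R D 0) := by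
  rw [← map_ofNat (algebraMap R (QuadraticAlgebra R D 0)) 2]
  exact h.map _

/-- The ring homomorphism out of `R[√D]` extending `φ` and sending `√D` to `u`. -/
def liftRingHom {A : Type*} [CommRing A] (φ : R →+* A) (u : A) (h : u ^ 2 = φ D) :
    QuadraticAlgebra R D 0 →+* A where
  toFun z := φ z.re + φ z.im * u
  map_one' := by simp
  map_zero' := by simp
  map_add' x y := by simp; ring
  map_mul' x y := by
    simp only [re_mul, im_mul, map_add, map_mul, zero_mul, add_zero]
    linear_combination -(φ x.im * φ y.im) * h

section liftRingHom

variable {A : Type*} [CommRing A] (φ : R →+* A) (u : A) (h : u ^ 2 = φ D)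

theorem liftRingHom_apply (z : QuadraticAlgebra R D 0) :
    liftRingHom φ u h z = φ z.re + φ z.im * u := rfl

@[simp]
theorem liftRingHom_omega : liftRingHom φ u h omega = u := by simp [liftRingHom_apply]

@[simp]
theorem liftRingHom_algebraMap (a : R) : liftRingHom φ u h (algebraMap R _ a) = φ a := by
  simp [liftRingHom_apply]

theorem ringHom_ext {f g : QuadraticAlgebra R D 0 →+* A}
    (h : f.comp (algebraMap R _) = g.comp (algebraMap R _)) (hω : f omega = g omega) : f = g := by
  ext ⟨a, b⟩
  have ha := RingHom.congr_fun h a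
  have hb := RingHom.congr_fun h b
  simp only [RingHom.comp_apply] at ha hb
  rw [mk_eq_algebraMap_add, map_add, map_mul, map_add, map_mul, ha, hb, hω]

end liftRingHom

variable [IsDomain R] [IsIntegrallyClosed R]

theorem eq_zero_of_sq_eq_mul_sq (hD : ¬IsSquare D) {a b : R} (h : a ^ 2 = D * b ^ 2) :
    b = 0 := by
  by_contra hb
  obtain ⟨c, rfl⟩ : b ∣ a :=
    (IsIntegrallyClosed.pow_dvd_pow_iff two_ne_zero).1 ⟨D, by rw [h, mul_comm]⟩
  exact hD ⟨c, mul_right_cancel₀ (pow_ne_zero 2 hb) (by rw [← h]; ring)⟩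

theorem norm_ne_zero (hD : ¬IsSquare D) {x : QuadraticAlgebra R D 0} (hx : x ≠ 0) :
    x.norm ≠ 0 := by
  intro h
  rw [norm_def] at h
  have him : x.im = 0 := eq_zero_of_sq_eq_mul_sq hD (a := x.re) (by linear_combination h)
  refine hx (QuadraticAlgebra.ext ?_ him)
  simpa [him] using h

theorem isDomain_of_not_isSquare (hD : ¬IsSquare D) : IsDomain (QuadraticAlgebra R D 0) := by
  have : NoZeroDivisors (QuadraticAlgebra R D 0) := ⟨fun {x y} h ↦ by
    by_contra! hxy
    have := congrArg norm h
    rw [map_mul, norm_zero, mul_eq_zero] at this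
    exact this.elim (norm_ne_zero hD hxy.1) (norm_ne_zero hD hxy.2)⟩
  exact NoZeroDivisors.to_isDomain _

/-- Adjoining the square root of a radical nonunit to an integrally closed domain in which `2` is
invertible gives an integrally closed domain. -/
theorem isIntegrallyClosed_of_isRadical (h2 : IsUnit (2 : R)) (hD : IsRadical D)
    (hu : ¬IsUnit D) (h0 : D ≠ 0) : IsIntegrallyClosed (QuadraticAlgebra R D 0) := by
  have hsq := hD.not_isSquare hu h0
  have := isDomain_of_not_isSquare hsq
  set S := QuadraticAlgebra R D 0
  let L := FractionRing S
  rw [isIntegrallyClosed_iff L]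
  intro x hx
  have hxR : IsIntegral R x := isIntegral_trans x hx
  have hSL : Function.Injective (algebraMap S L) := IsFractionRing.injective S L
  have hRL : Function.Injective (algebraMap R L) := by
    rw [IsScalarTower.algebraMap_eq R S L]
    exact hSL.comp algebraMap_injective
  obtain ⟨u, v, hv, rfl⟩ := IsFractionRing.div_surjective (A := S) x
  have hv0 : v ≠ 0 := nonZeroDivisors.ne_zero hv
  let n := v.norm
  have hn : n ≠ 0 := norm_ne_zero hsq hv0
  have hnL : algebraMap R L n ≠ 0 := by simpa using hRL.ne hn
  obtain ⟨a, b, hab⟩ : ∃ a b, u * star v = (⟨a, b⟩ : S) := ⟨_, _, rfl⟩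
  let r : L := algebraMap S L omega
  have hr : r ^ 2 = algebraMap R L D := by
    rw [IsScalarTower.algebraMap_apply R S L, ← omega_sq, map_pow]
  have hx : algebraMap R L n * (algebraMap S L u / algebraMap S L v) =
      algebraMap R L a + algebraMap R L b * r := by
    have hvL : algebraMap S L v ≠ 0 := by simpa using hSL.ne hv0
    have : algebraMap S L u * algebraMap S L (star v) =
        algebraMap R L a + algebraMap R L b * r := by
      rw [← map_mul, hab, mk_eq_algebraMap_add, map_add, map_mul]
      rfl
    rw [← this, IsScalarTower.algebraMap_apply R S L, algebraMap_norm_eq_mul_star, map_mul]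
    rw [← mul_div_assoc, div_eq_iff hvL]
    ring
  generalize algebraMap S L u / algebraMap S L v = x at hx hxR
  let conj : S ≃ₐ[R] S := AlgEquiv.ofRingEquiv (f := starRingAut) star_algebraMap
  let τ : L ≃ₐ[R] L := IsFractionRing.algEquivOfAlgEquiv conj
  have hτ : τ r = -r := by
    change IsFractionRing.algEquivOfAlgEquiv conj (algebraMap S L omega) = _
    rw [IsFractionRing.algEquivOfAlgEquiv_algebraMap, ← map_neg]
    exact congrArg _ star_omega
  have hx' : algebraMap R L n * τ x = algebraMap R L a - algebraMap R L b * r := by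
    have := congrArg τ hx
    rw [map_mul, map_add, map_mul, AlgEquiv.commutes, AlgEquiv.commutes, AlgEquiv.commutes,
      hτ] at this
    rw [this]; ring
  have hτR : IsIntegral R (τ x) := hxR.map τ
  obtain ⟨a', rfl⟩ : n ∣ a := by
    rw [← h2.dvd_mul_left]
    refine IsIntegrallyClosed.dvd_of_isIntegral hRL (hxR.add hτR) hn ?_
    rw [map_mul, map_ofNat]
    linear_combination hx + hx'
  have hxa_int : IsIntegral R (x - algebraMap R L a') := hxR.sub isIntegral_algebraMap
  have hxa : algebraMap R L n * (x - algebraMap R L a') = algebraMap R L b * r := by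
    rw [map_mul] at hx
    linear_combination hx
  obtain ⟨e, he⟩ : n ^ 2 ∣ b ^ 2 * D := by
    refine IsIntegrallyClosed.dvd_of_isIntegral hRL (hxa_int.pow 2) (pow_ne_zero 2 hn) ?_
    rw [map_pow, ← mul_pow, hxa, mul_pow, hr, map_mul, map_pow]
  obtain ⟨c, hc⟩ : n ∣ b * D :=
    (IsIntegrallyClosed.pow_dvd_pow_iff two_ne_zero).1
      ⟨e * D, by linear_combination D * he⟩
  obtain ⟨b', rfl⟩ : D ∣ c := hD 2 c ⟨e, mul_left_cancel₀ (pow_ne_zero 2 hn) (by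
    linear_combination D * he - (b * D + n * c) * hc)⟩
  obtain rfl : b = n * b' := mul_right_cancel₀ h0 (by linear_combination hc)
  refine ⟨⟨a', b'⟩, mul_left_cancel₀ hnL ?_⟩
  rw [hx, mk_eq_algebraMap_add, map_add, map_mul, map_mul, map_mul,
    ← IsScalarTower.algebraMap_apply R S L, ← IsScalarTower.algebraMap_apply R S L]
  ring

/-- The element `d + 8 √D` of `R[√(√D)]`. -/
def addOmegaSq {R : Type*} [CommRing R] {D : R} (d : R) :
    QuadraticAlgebra (QuadraticAlgebra R D 0) omega 0 :=
  algebraMap _ _ (algebraMap R (QuadraticAlgebra R D 0) d) + 8 * omega ^ 2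

theorem map_addOmegaSq {R S : Type*} [CommRing R] [CommRing S] {D : R} (d : R)
    (φ : QuadraticAlgebra (QuadraticAlgebra R D 0) omega 0 →+* S) :
    φ (addOmegaSq d) =
      φ (algebraMap _ _ (algebraMap R (QuadraticAlgebra R D 0) d)) + 8 * φ omega ^ 2 := by
  rw [addOmegaSq, map_add, map_mul, map_pow, map_ofNat]

/-- Let `ρ` be a ring homomorphism with kernel generated by `d² - 64 D` and let `φ` be an extension
of `ρ` to `R[√(√D)]` whose values at `1` and `√(√D)` are linearly independent. Then the kernel of
`φ` is generated by `d + 8 √D`. -/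
theorem addOmegaSq_dvd_of_map_eq_zero {R P : Type*} [CommRing R] [CommRing P] {D d : R} {g : P}
    (h2 : IsUnit (2 : R)) {ρ : R →+* P} (hd : ρ d = -8 * g)
    (hker : ∀ r, ρ r = 0 → d ^ 2 - 64 * D ∣ r)
    (φ : QuadraticAlgebra (QuadraticAlgebra R D 0) omega 0 →+* QuadraticAlgebra P g 0)
    (hφ : ∀ r, φ (algebraMap _ _ (algebraMap R (QuadraticAlgebra R D 0) r)) = algebraMap _ _ (ρ r))
    (hω : φ omega = omega) {c : QuadraticAlgebra (QuadraticAlgebra R D 0) omega 0}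
    (hc : φ c = 0) : addOmegaSq d ∣ c := by
  obtain ⟨⟨a₀, a₁⟩, ⟨b₀, b₁⟩⟩ := c
  let ι : R →+* QuadraticAlgebra (QuadraticAlgebra R D 0) omega 0 :=
    (algebraMap _ _).comp (algebraMap R (QuadraticAlgebra R D 0))
  obtain ⟨z, hz⟩ : ∃ z : QuadraticAlgebra (QuadraticAlgebra R D 0) omega 0, z = omega := ⟨_, rfl⟩
  have hz2 : algebraMap _ _ (omega : QuadraticAlgebra R D 0) = z ^ 2 := by
    rw [hz, omega_sq]
  have hz4 : (z ^ 2) ^ 2 = ι D := by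
    rw [← hz2, ← map_pow, omega_sq]
    rfl
  have hc' : (⟨⟨a₀, a₁⟩, ⟨b₀, b₁⟩⟩ : QuadraticAlgebra (QuadraticAlgebra R D 0) omega 0) =
      ι a₀ + ι a₁ * z ^ 2 + (ι b₀ + ι b₁ * z ^ 2) * z := by
    rw [mk_eq_algebraMap_add, mk_eq_algebraMap_add, mk_eq_algebraMap_add, map_add, map_add,
      map_mul, map_mul, hz2, hz]
    rfl
  change ι d + 8 * omega ^ 2 ∣ _
  rw [hc', ← hz]
  rw [hc'] at hc
  replace hφ (r : R) : φ (ι r) = algebraMap _ _ (ρ r) := hφ r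
  have hq : 8 * (ι a₀ + ι a₁ * z ^ 2 + (ι b₀ + ι b₁ * z ^ 2) * z) =
      (ι d + 8 * z ^ 2) * (ι a₁ + ι b₁ * z) +
        (ι (8 * a₀ - d * a₁) + ι (8 * b₀ - d * b₁) * z) := by
    simp only [map_sub, map_mul, map_ofNat]
    ring
  have hφd : φ (ι d + 8 * z ^ 2) = 0 := by
    rw [map_add, hφ, hd, map_mul φ, map_pow, hz, hω, omega_sq, map_mul, map_neg, map_ofNat,
      map_ofNat]
    ring
  have h := congrArg φ hq
  rw [map_mul, hc, mul_zero, map_add φ, map_mul φ, hφd, zero_mul, zero_add, map_add φ, map_mul φ,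
    hφ, hφ, hz, hω, ← mk_eq_algebraMap_add] at h
  have key (r : R) (hr : ρ r = 0) : ι d + 8 * z ^ 2 ∣ ι r := by
    refine Dvd.dvd.trans ⟨ι d - 8 * z ^ 2, ?_⟩ (map_dvd ι (hker r hr))
    rw [map_sub, map_mul, map_pow, ← hz4, map_ofNat]
    ring
  have h8 : IsUnit (8 : QuadraticAlgebra (QuadraticAlgebra R D 0) omega 0) := by
    rw [← map_ofNat ι 8, show (8 : R) = 2 ^ 3 by norm_num]
    exact (h2.pow 3).map ι
  rw [← h8.dvd_mul_left, hq]
  exact (dvd_mul_right _ _).add ((key _ (congrArg QuadraticAlgebra.re h).symm).add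
    ((key _ (congrArg QuadraticAlgebra.im h).symm).mul_right _))

end QuadraticAlgebra

namespace Threefold

/-- The ring `ℂ[y₀, y₁, y₂, t]`, as polynomials in `t`. -/
abbrev Base := Polynomial (MvPolynomial (Fin 3) ℂ)

/-- The coordinate `yᵢ`. -/
noncomputable abbrev y (i : Fin 3) : Base := Polynomial.C (X i)

/-- The coordinate `t`, which stands for `y₀ + y₁ + y₂ + y₃ + y₄`. -/
noncomputable abbrev t : Base := Polynomial.X

/-- The product of the four coordinates. -/
noncomputable def quartic : Base := y 0 * (y 1 * (y 2 * t))

/-- The quadratic form `(t - y₀ - y₁ - y₂)² - 4 (y₀y₁ + y₀y₂ + y₁y₂)`. -/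
noncomputable def quad : Base :=
  (t - (y 0 + y 1 + y 2)) ^ 2 - 4 * (y 0 * y 1 + y 0 * y 2 + y 1 * y 2)

/-- Evaluation of the coordinates `yᵢ` at `v` and of `t` at `c`. -/
noncomputable def evalAt (v : Fin 3 → ℂ) (c : ℂ) : Base →+* ℂ :=
  Polynomial.eval₂RingHom (eval v) c

@[simp]
theorem evalAt_y (v : Fin 3 → ℂ) (c : ℂ) (i : Fin 3) : evalAt v c (y i) = v i := by
  simp [evalAt]

@[simp]
theorem evalAt_t (v : Fin 3 → ℂ) (c : ℂ) : evalAt v c t = c := by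
  simp [evalAt]

theorem not_dvd_of_evalAt (v : Fin 3 → ℂ) (c : ℂ) {p q : Base} (hp : evalAt v c p = 0)
    (hq : evalAt v c q ≠ 0) : ¬p ∣ q := fun h ↦
  hq (zero_dvd_iff.1 (hp ▸ map_dvd (evalAt v c) h))

theorem prime_y (i : Fin 3) : Prime (y i) :=
  Polynomial.prime_C_iff.2 (X_prime)

theorem isRadical_quartic : IsRadical quartic := by
  refine (prime_y 0).isRadical_mul ((prime_y 1).isRadical_mul ((prime_y 2).isRadical_mul
    Polynomial.prime_X.isRadical ?_) ?_) ?_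
  · exact not_dvd_of_evalAt ![1, 1, 0] 1 (by simp) (by simp)
  · exact not_dvd_of_evalAt ![1, 0, 1] 1 (by simp) (by simp)
  · exact not_dvd_of_evalAt ![0, 1, 1] 1 (by simp) (by simp)

theorem quartic_ne_zero : quartic ≠ 0 := by
  simp [quartic]

theorem not_isUnit_quartic : ¬IsUnit quartic := fun h ↦ by
  simpa [quartic] using h.map (evalAt 0 0)

theorem isUnit_two_base : IsUnit (2 : Base) := by
  rw [← map_ofNat (algebraMap ℂ Base) 2]
  exact (IsUnit.mk0 _ two_ne_zero).map _

/-- The ring `ℂ[y₀, y₁, y₂, t, w] / (w² - y₀y₁y₂t)`. -/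
abbrev Cover₂ := QuadraticAlgebra Base quartic 0

/-- The ring `ℂ[y₀, y₁, y₂, t, z] / (z⁴ - y₀y₁y₂t)`. -/
abbrev Cover₄ := QuadraticAlgebra Cover₂ QuadraticAlgebra.omega 0

/-- The squares of the linear forms `±a₀ ± a₁ ± a₂`, up to an overall sign. -/
noncomputable def signedSquare (i : Fin 4) : MvPolynomial (Fin 3) ℂ :=
  (∑ j, C ((![![1, 1, 1], ![-1, 1, 1], ![1, -1, 1], ![1, 1, -1]] : Fin 4 → Fin 3 → ℂ) i j) *
    X j) ^ 2

theorem signedSquare_injective : Function.Injective signedSquare := by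
  intro i j h
  have := congrArg (eval ![1, 2, 4]) h
  fin_cases i <;> fin_cases j <;> first
    | rfl
    | (simp [signedSquare, Fin.sum_univ_three] at this; norm_num at this)

/-- The parametrization `yᵢ = aᵢ²`, `t = (a₀ + a₁ + a₂)²`. -/
noncomputable def param : Base →+* MvPolynomial (Fin 3) ℂ :=
  Polynomial.eval₂RingHom (expand 2 : _ →ₐ[ℂ] MvPolynomial (Fin 3) ℂ).toRingHom
    ((X 0 + X 1 + X 2) ^ 2)

@[simp]
theorem param_y (i : Fin 3) : param (y i) = X i ^ 2 := by
  simp [param]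

@[simp]
theorem param_t : param t = (X 0 + X 1 + X 2) ^ 2 := by
  simp [param]

/-- The value of `z²` in the parametrization of the branch locus. -/
noncomputable def radicand : MvPolynomial (Fin 3) ℂ := -(X 0 * X 1 * X 2 * (X 0 + X 1 + X 2))

theorem param_quad : param quad = -8 * radicand := by
  simp only [quad, radicand, map_sub, map_pow, map_add, map_mul, param_y, param_t, map_ofNat]
  ring

theorem param_quartic : param quartic = radicand ^ 2 := by
  simp only [quartic, radicand, map_mul, param_y, param_t]
  ring

theorem eval_signedSquare (m : Base) (hm : param m = 0) (i : Fin 4) :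
    (m.map (expand 2 : _ →ₐ[ℂ] MvPolynomial (Fin 3) ℂ).toRingHom).eval (signedSquare i) = 0 := by
  set ε : Fin 3 → ℂ := (![![1, 1, 1], ![-1, 1, 1], ![1, -1, 1], ![1, 1, -1]] : Fin 4 → Fin 3 → ℂ) i
    with hε
  have hε2 (j : Fin 3) : ε j ^ 2 = 1 := by
    rw [hε]; fin_cases i <;> fin_cases j <;> simp
  let τ : MvPolynomial (Fin 3) ℂ →ₐ[ℂ] MvPolynomial (Fin 3) ℂ := aeval fun j ↦ C (ε j) * X j
  have hτ : τ.toRingHom.comp (expand 2 : _ →ₐ[ℂ] MvPolynomial (Fin 3) ℂ).toRingHom =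
      (expand 2 : _ →ₐ[ℂ] MvPolynomial (Fin 3) ℂ).toRingHom := by
    refine ringHom_ext (fun c ↦ by simp [τ]) (fun j ↦ ?_)
    simp [τ, mul_pow, ← C_pow, hε2]
  have hX : signedSquare i = τ ((X 0 + X 1 + X 2) ^ 2) := by
    simp [τ, signedSquare, Fin.sum_univ_three, hε]
  have := congrArg τ hm
  rw [map_zero] at this
  rw [Polynomial.eval_map, ← this, hX]
  conv_lhs => rw [← hτ]
  exact (Polynomial.hom_eval₂ m _ τ.toRingHom _).symm

theorem monic_quad_sq_sub : (quad ^ 2 - 64 * quartic).Monic ∧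
    (quad ^ 2 - 64 * quartic).natDegree = 4 := by
  have h : quad ^ 2 - 64 * quartic = (Polynomial.X ^ 2 - Polynomial.C (2 * (X 0 + X 1 + X 2)) *
      Polynomial.X + Polynomial.C ((X 0 + X 1 + X 2) ^ 2 - 4 * (X 0 * X 1 + X 0 * X 2 + X 1 * X 2)))
      ^ 2 - Polynomial.C (64 * (X 0 * X 1 * X 2)) * Polynomial.X := by
    simp only [quad, quartic, y, t, map_mul, map_add, map_sub, map_pow, map_ofNat]
    ring
  rw [h]
  constructor
  · monicity!
  · compute_degree!

theorem dvd_of_param_eq_zero {r : Base} (hr : param r = 0) : quad ^ 2 - 64 * quartic ∣ r := by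
  obtain ⟨hF, hdeg⟩ := monic_quad_sq_sub
  set F := quad ^ 2 - 64 * quartic with hFdef
  have hparamF : param F = 0 := by
    rw [hFdef, map_sub, map_pow, map_mul, param_quad, param_quartic, map_ofNat]
    ring
  rw [← Polynomial.modByMonic_eq_zero_iff_dvd hF]
  have hm : param (r %ₘ F) = 0 := by
    have := congrArg param (Polynomial.modByMonic_add_div r F)
    rwa [map_add, map_mul, hparamF, zero_mul, add_zero, hr] at this
  have hinj : Function.Injective (expand 2 : _ →ₐ[ℂ] MvPolynomial (Fin 3) ℂ).toRingHom :=
    expand_injective two_pos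
  rw [← Polynomial.map_eq_zero_iff hinj]
  refine Polynomial.eq_zero_of_natDegree_lt_card_of_eval_eq_zero _ signedSquare_injective
    (eval_signedSquare _ hm) ?_
  rw [Polynomial.natDegree_map_eq_of_injective hinj, Fintype.card_fin, ← hdeg]
  exact Polynomial.natDegree_modByMonic_lt _ hF fun h ↦ by simp [h] at hdeg

/-- The discriminant of `(T - y₃) (T - y₄)`, written in terms of `y₀, y₁, y₂, t, z`. -/
noncomputable def disc : Cover₄ :=
  QuadraticAlgebra.addOmegaSq quad

theorem not_isSquare_radicand : ¬IsSquare radicand := by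
  rintro ⟨h, hh⟩
  obtain ⟨k, rfl⟩ : (X 0 : MvPolynomial (Fin 3) ℂ) ∣ h := by
    refine (X_prime.dvd_mul.1 (hh ▸ ?_ : X 0 ∣ h * h)).elim id id
    exact ⟨-(X 1 * X 2 * (X 0 + X 1 + X 2)), by rw [radicand]; ring⟩
  have : -(X 1 * X 2 * (X 0 + X 1 + X 2)) = X 0 * k ^ 2 :=
    mul_left_cancel₀ (X_ne_zero (0 : Fin 3)) (by rw [radicand] at hh; linear_combination hh)
  have := congrArg (eval ![0, 1, 1]) this
  simp at this

/-- The double cover of affine space on which the branch locus is parametrized. -/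
abbrev BranchCover := QuadraticAlgebra (MvPolynomial (Fin 3) ℂ) radicand 0

instance : IsDomain BranchCover :=
  QuadraticAlgebra.isDomain_of_not_isSquare not_isSquare_radicand

/-- The parametrization of the branch locus `disc = 0`. -/
noncomputable def branchParam : Cover₄ →+* BranchCover :=
  QuadraticAlgebra.liftRingHom
    (QuadraticAlgebra.liftRingHom ((algebraMap _ BranchCover).comp param)
      (algebraMap _ BranchCover radicand) (by
        rw [RingHom.comp_apply, param_quartic, map_pow]))
    QuadraticAlgebra.omega
    (by rw [QuadraticAlgebra.liftRingHom_omega, QuadraticAlgebra.omega_sq])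

theorem isUnit_two_cover₄ : IsUnit (2 : Cover₄) :=
  QuadraticAlgebra.isUnit_two (QuadraticAlgebra.isUnit_two isUnit_two_base)

theorem branchParam_base (r : Base) :
    branchParam (algebraMap Cover₂ Cover₄ (algebraMap Base Cover₂ r)) =
      algebraMap _ BranchCover (param r) := by
  rw [branchParam, QuadraticAlgebra.liftRingHom_algebraMap,
    QuadraticAlgebra.liftRingHom_algebraMap, RingHom.comp_apply]

theorem branchParam_omega : branchParam QuadraticAlgebra.omega = QuadraticAlgebra.omega :=
  QuadraticAlgebra.liftRingHom_omega _ _ _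

theorem branchParam_disc : branchParam disc = 0 := by
  rw [disc, QuadraticAlgebra.map_addOmegaSq, branchParam_base, branchParam_omega,
    QuadraticAlgebra.omega_sq, param_quad, map_mul, map_neg, map_ofNat]
  ring

theorem disc_dvd_of_branchParam_eq_zero {c : Cover₄} (hc : branchParam c = 0) : disc ∣ c :=
  QuadraticAlgebra.addOmegaSq_dvd_of_map_eq_zero isUnit_two_base param_quad
    (fun _ ↦ dvd_of_param_eq_zero) branchParam branchParam_base branchParam_omega hc

theorem isRadical_disc : IsRadical disc := fun n c h ↦ by
  refine disc_dvd_of_branchParam_eq_zero (eq_zero_of_pow_eq_zero (n := n) ?_)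
  rw [← map_pow]
  exact zero_dvd_iff.1 (branchParam_disc ▸ map_dvd branchParam h)

theorem not_isUnit_disc : ¬IsUnit disc := fun h ↦ by
  have := h.map branchParam
  rw [branchParam_disc] at this
  exact not_isUnit_zero this

theorem disc_ne_zero : disc ≠ 0 := fun h ↦ by
  let φ : Cover₄ →+* ℂ := QuadraticAlgebra.liftRingHom
    (QuadraticAlgebra.liftRingHom (evalAt 0 1) 0 (by simp [quartic])) 0 (by simp)
  have := congrArg φ h
  rw [disc, QuadraticAlgebra.map_addOmegaSq, QuadraticAlgebra.liftRingHom_omega,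
    QuadraticAlgebra.liftRingHom_algebraMap, QuadraticAlgebra.liftRingHom_algebraMap] at this
  simp [quad] at this

theorem not_isUnit_omega₂ : ¬IsUnit (QuadraticAlgebra.omega : Cover₂) := fun h ↦ by
  have := h.map (QuadraticAlgebra.liftRingHom (evalAt 0 0) 0 (by simp [quartic]))
  rw [QuadraticAlgebra.liftRingHom_omega] at this
  exact not_isUnit_zero this

theorem omega₂_ne_zero : (QuadraticAlgebra.omega : Cover₂) ≠ 0 := fun h ↦
  one_ne_zero (congrArg QuadraticAlgebra.im h)

instance : IsDomain Cover₂ := QuadraticAlgebra.isDomain_of_not_isSquare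
  (isRadical_quartic.not_isSquare not_isUnit_quartic quartic_ne_zero)

instance : IsIntegrallyClosed Cover₂ := QuadraticAlgebra.isIntegrallyClosed_of_isRadical
  isUnit_two_base isRadical_quartic not_isUnit_quartic quartic_ne_zero

instance : IsDomain Cover₄ := QuadraticAlgebra.isDomain_of_not_isSquare
  ((QuadraticAlgebra.isRadical_omega isRadical_quartic).not_isSquare not_isUnit_omega₂
    omega₂_ne_zero)

instance : IsIntegrallyClosed Cover₄ := QuadraticAlgebra.isIntegrallyClosed_of_isRadical
  (QuadraticAlgebra.isUnit_two isUnit_two_base)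
  (QuadraticAlgebra.isRadical_omega isRadical_quartic) not_isUnit_omega₂ omega₂_ne_zero

/-- The double cover of `Cover₄` branched along `disc`. -/
abbrev Cover₈ := QuadraticAlgebra Cover₄ disc 0

instance : IsDomain Cover₈ := QuadraticAlgebra.isDomain_of_not_isSquare
  (isRadical_disc.not_isSquare not_isUnit_disc disc_ne_zero)

instance : IsIntegrallyClosed Cover₈ := QuadraticAlgebra.isIntegrallyClosed_of_isRadical
  isUnit_two_cover₄ isRadical_disc not_isUnit_disc disc_ne_zero

/-- The ideal of the threefold. -/
noncomputable abbrev ideal : Ideal (MvPolynomial (Fin 6) ℂ) := Ideal.span {fpoly, gpoly}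

/-- The homogeneous coordinate ring of the threefold. -/
abbrev CoordRing := MvPolynomial (Fin 6) ℂ ⧸ ideal

/-- The class of the `i`-th coordinate. -/
noncomputable def coord (i : Fin 6) : CoordRing := Ideal.Quotient.mk ideal (X i)

theorem coord_quartic : coord 5 ^ 4 =
    coord 0 * coord 1 * coord 2 * (coord 0 + coord 1 + coord 2 + coord 3 + coord 4) :=
  Ideal.Quotient.eq.2 (Ideal.subset_span (Set.mem_insert fpoly _))

theorem coord_quadric : 2 * coord 5 ^ 2 =
    coord 0 * coord 1 + coord 0 * coord 2 + coord 1 * coord 2 - coord 3 * coord 4 :=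
  Ideal.Quotient.eq.2 (Ideal.subset_span (Set.mem_insert_of_mem _ (Set.mem_singleton gpoly)))

/-- The inclusion of `ℂ[y₀, y₁, y₂, t]` into the coordinate ring. -/
noncomputable def baseToCoord : Base →+* CoordRing :=
  Polynomial.eval₂RingHom (aeval ![coord 0, coord 1, coord 2]).toRingHom
    (coord 0 + coord 1 + coord 2 + coord 3 + coord 4)

theorem baseToCoord_y (i : Fin 3) :
    baseToCoord (y i) = (![coord 0, coord 1, coord 2] : Fin 3 → CoordRing) i := by
  simp [baseToCoord]

theorem baseToCoord_t :
    baseToCoord t = coord 0 + coord 1 + coord 2 + coord 3 + coord 4 := by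
  simp [baseToCoord]

theorem baseToCoord_quartic : (coord 5 ^ 2) ^ 2 = baseToCoord quartic := by
  simp only [quartic, map_mul, baseToCoord_y, baseToCoord_t, Matrix.cons_val]
  linear_combination coord_quartic

/-- The inclusion of `ℂ[y₀, y₁, y₂, t, z] / (z⁴ - y₀y₁y₂t)` into the coordinate ring. -/
noncomputable def cover₄ToCoord : Cover₄ →+* CoordRing :=
  QuadraticAlgebra.liftRingHom
    (QuadraticAlgebra.liftRingHom baseToCoord (coord 5 ^ 2) baseToCoord_quartic) (coord 5)
    (QuadraticAlgebra.liftRingHom_omega _ _ _).symm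

theorem cover₄ToCoord_omega : cover₄ToCoord QuadraticAlgebra.omega = coord 5 :=
  QuadraticAlgebra.liftRingHom_omega _ _ _

theorem cover₄ToCoord_base (r : Base) :
    cover₄ToCoord (algebraMap Cover₂ Cover₄ (algebraMap Base Cover₂ r)) = baseToCoord r := by
  rw [cover₄ToCoord, QuadraticAlgebra.liftRingHom_algebraMap,
    QuadraticAlgebra.liftRingHom_algebraMap]

theorem cover₄ToCoord_disc : (coord 3 - coord 4) ^ 2 = cover₄ToCoord disc := by
  rw [disc, QuadraticAlgebra.map_addOmegaSq, cover₄ToCoord_base, cover₄ToCoord_omega]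
  simp only [quad, map_mul, map_sub, map_add, map_pow, map_ofNat, baseToCoord_y, baseToCoord_t,
    Matrix.cons_val]
  linear_combination -4 * coord_quadric

/-- The homomorphism from the iterated double cover to the coordinate ring. -/
noncomputable def toCoord : Cover₈ →+* CoordRing :=
  QuadraticAlgebra.liftRingHom cover₄ToCoord (coord 3 - coord 4) cover₄ToCoord_disc

/-- The inclusion of `ℂ[y₀, y₁, y₂, t]` into the iterated double cover. -/
noncomputable def ofBase : Base →+* Cover₈ :=
  ((algebraMap Cover₄ Cover₈).comp (algebraMap Cover₂ Cover₄)).comp (algebraMap Base Cover₂)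

/-- The fourth root of `y₀y₁y₂t`. -/
noncomputable def z : Cover₈ := algebraMap Cover₄ Cover₈ QuadraticAlgebra.omega

/-- The square root of the discriminant. -/
noncomputable def δ : Cover₈ := QuadraticAlgebra.omega

theorem z_sq : z ^ 2 =
    algebraMap Cover₄ Cover₈ (algebraMap Cover₂ Cover₄ QuadraticAlgebra.omega) := by
  rw [z, ← map_pow, QuadraticAlgebra.omega_sq]

theorem z_pow_four : z ^ 4 = ofBase quartic := by
  rw [show z ^ 4 = (z ^ 2) ^ 2 by ring, z_sq, ← map_pow, ← map_pow, QuadraticAlgebra.omega_sq]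
  rfl

theorem algebraMap_disc : algebraMap Cover₄ Cover₈ disc = ofBase quad + 8 * z ^ 2 := by
  have hd : algebraMap Cover₄ Cover₈ disc =
    algebraMap Cover₄ Cover₈ (QuadraticAlgebra.addOmegaSq quad) := rfl
  have h := QuadraticAlgebra.map_addOmegaSq quad (algebraMap Cover₄ Cover₈)
  rw [ofBase, z, RingHom.comp_apply, RingHom.comp_apply]
  linear_combination hd + h

theorem δ_sq : δ ^ 2 = ofBase quad + 8 * z ^ 2 := by
  rw [δ, QuadraticAlgebra.omega_sq, algebraMap_disc]

theorem ofBase_algebraMap (c : ℂ) : ofBase (algebraMap ℂ Base c) = algebraMap ℂ Cover₈ c := rfl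

/-- The constant `1 / 2`. -/
noncomputable def half : Cover₈ := algebraMap ℂ Cover₈ (1 / 2)

theorem two_mul_half : 2 * half = 1 := by
  rw [half, ← map_ofNat (algebraMap ℂ Cover₈) 2, ← map_mul]
  norm_num

/-- The images of the six coordinates in the iterated double cover. -/
noncomputable def root : Fin 6 → Cover₈ :=
  ![ofBase (y 0), ofBase (y 1), ofBase (y 2),
    half * (ofBase (t - (y 0 + y 1 + y 2)) + δ), half * (ofBase (t - (y 0 + y 1 + y 2)) - δ), z]

theorem aeval_root_mem (p : MvPolynomial (Fin 6) ℂ) (hp : p ∈ ideal) : aeval root p = 0 := by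
  suffices ideal ≤ RingHom.ker (aeval root : _ →ₐ[ℂ] Cover₈) from this hp
  rw [Ideal.span_le]
  rintro _ (rfl | rfl)
  · have h := z_pow_four
    simp only [quartic, map_mul] at h
    simp only [SetLike.mem_coe, RingHom.mem_ker, fpoly, map_sub, map_mul, map_add, map_pow,
      aeval_X, root, Matrix.cons_val]
    generalize ofBase (y 0) = a at *
    generalize ofBase (y 1) = b at *
    generalize ofBase (y 2) = c at *
    generalize ofBase t = d at *
    linear_combination h - a * b * c * (d - a - b - c) * two_mul_half
  · have h := δ_sq
    simp only [quad, map_mul, map_sub, map_add, map_pow, map_ofNat] at h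
    simp only [SetLike.mem_coe, RingHom.mem_ker, gpoly, map_sub, map_mul, map_add, map_pow,
      aeval_X, root, Matrix.cons_val, map_ofNat]
    generalize ofBase (y 0) = a at *
    generalize ofBase (y 1) = b at *
    generalize ofBase (y 2) = c at *
    generalize ofBase t = d at *
    linear_combination -half ^ 2 * h +
      (2 * z ^ 2 - (a * b + a * c + b * c)) * (-2 * half - 1) * two_mul_half

/-- The homomorphism from the coordinate ring to the iterated double cover. -/
noncomputable def ofCoord : CoordRing →+* Cover₈ :=
  Ideal.Quotient.lift ideal (aeval root).toRingHom aeval_root_mem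

theorem ofCoord_coord (i : Fin 6) : ofCoord (coord i) = root i := by
  simp [ofCoord, coord]

theorem toCoord_ofBase (r : Base) : toCoord (ofBase r) = baseToCoord r := by
  rw [toCoord, ofBase, RingHom.comp_apply, RingHom.comp_apply,
    QuadraticAlgebra.liftRingHom_algebraMap, cover₄ToCoord_base]

theorem toCoord_z : toCoord z = coord 5 := by
  rw [toCoord, z, QuadraticAlgebra.liftRingHom_algebraMap, cover₄ToCoord_omega]

theorem toCoord_δ : toCoord δ = coord 3 - coord 4 :=
  QuadraticAlgebra.liftRingHom_omega _ _ _

theorem toCoord_algebraMap (c : ℂ) :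
    toCoord (algebraMap ℂ Cover₈ c) = algebraMap ℂ CoordRing c := by
  rw [← ofBase_algebraMap, toCoord_ofBase, baseToCoord]
  simp [Polynomial.algebraMap_apply]

theorem toCoord_comp_ofCoord : toCoord.comp ofCoord = RingHom.id CoordRing := by
  refine Ideal.Quotient.ringHom_ext (MvPolynomial.ringHom_ext (fun c ↦ ?_) fun i ↦ ?_)
  · change toCoord (ofCoord (Ideal.Quotient.mk ideal (C c))) = _
    rw [ofCoord, Ideal.Quotient.lift_mk]
    change toCoord (aeval root (C c)) = _
    rw [aeval_C, toCoord_algebraMap]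
    rfl
  · change toCoord (ofCoord (coord i)) = coord i
    have h : 2 * toCoord half = 1 := by
      rw [← map_ofNat toCoord 2, ← map_mul, two_mul_half, map_one]
    rw [ofCoord_coord]
    fin_cases i <;>
      simp only [root, Fin.zero_eta, Fin.mk_one, Fin.reduceFinMk, Matrix.cons_val, toCoord_ofBase,
        map_mul, map_add, map_sub, toCoord_z, toCoord_δ, baseToCoord_y, baseToCoord_t]
    · linear_combination coord 3 * h
    · linear_combination coord 4 * h

theorem ofCoord_baseToCoord (r : Base) : ofCoord (baseToCoord r) = ofBase r := by
  suffices ofCoord.comp baseToCoord = ofBase from RingHom.congr_fun this r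
  refine Polynomial.ringHom_ext' (MvPolynomial.ringHom_ext (fun c ↦ ?_) fun i ↦ ?_) ?_
  · change ofCoord (baseToCoord (algebraMap ℂ Base c)) = ofBase (algebraMap ℂ Base c)
    rw [← toCoord_ofBase, ofBase_algebraMap, toCoord_algebraMap]
    change ofCoord (Ideal.Quotient.mk ideal (C c)) = _
    rw [ofCoord, Ideal.Quotient.lift_mk]
    exact aeval_C root c
  · change ofCoord (baseToCoord (y i)) = ofBase (y i)
    rw [baseToCoord_y]
    fin_cases i <;> simp [ofCoord_coord, root]
  · change ofCoord (baseToCoord t) = ofBase t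
    rw [baseToCoord_t]
    simp only [map_add, ofCoord_coord, root, Matrix.cons_val, map_sub]
    linear_combination (ofBase t - ofBase (y 0) - ofBase (y 1) - ofBase (y 2)) * two_mul_half

theorem ofCoord_comp_toCoord : ofCoord.comp toCoord = RingHom.id Cover₈ := by
  refine QuadraticAlgebra.ringHom_ext (QuadraticAlgebra.ringHom_ext
    (QuadraticAlgebra.ringHom_ext (RingHom.ext fun r ↦ ?_) ?_) ?_) ?_
  · change ofCoord (toCoord (ofBase r)) = ofBase r
    rw [toCoord_ofBase, ofCoord_baseToCoord]
  · change ofCoord (toCoord (algebraMap Cover₄ Cover₈ (algebraMap Cover₂ Cover₄ _))) =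
      algebraMap Cover₄ Cover₈ (algebraMap Cover₂ Cover₄ _)
    rw [← z_sq, map_pow, toCoord_z, map_pow, ofCoord_coord]
    rfl
  · change ofCoord (toCoord z) = z
    rw [toCoord_z, ofCoord_coord]
    rfl
  · change ofCoord (toCoord δ) = δ
    rw [toCoord_δ, map_sub, ofCoord_coord, ofCoord_coord]
    simp only [root, Matrix.cons_val]
    linear_combination δ * two_mul_half

/-- The coordinate ring is an iterated double cover of affine four-space. -/
noncomputable def coordEquiv : Cover₈ ≃+* CoordRing :=
  RingEquiv.ofRingHom toCoord ofCoord toCoord_comp_ofCoord ofCoord_comp_toCoord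

end Threefold

/-- The ideal `I = (f, g)` is prime and the quotient ring `ℂ[y₀,…,y₅]/I` is a
normal (integrally closed) integral domain. -/
theorem stmt_0 :
    (Ideal.span ({fpoly, gpoly} : Set (MvPolynomial (Fin 6) ℂ))).IsPrime ∧
    IsDomain (MvPolynomial (Fin 6) ℂ ⧸ Ideal.span ({fpoly, gpoly} : Set (MvPolynomial (Fin 6) ℂ))) ∧
    IsIntegrallyClosed
      (MvPolynomial (Fin 6) ℂ ⧸ Ideal.span ({fpoly, gpoly} : Set (MvPolynomial (Fin 6) ℂ))) := by
  have hdom : IsDomain Threefold.CoordRing := Threefold.coordEquiv.toMulEquiv.symm.isDomain _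
  exact ⟨(Ideal.Quotient.isDomain_iff_prime _).1 hdom, hdom,
    IsIntegrallyClosed.of_equiv Threefold.coordEquiv⟩
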